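/- arXiv:1810.09616 — 4 statements merged into one kernel-verified Lean document; each statement's English description precedes it below -/
import Mathlib

section
/- Let S be a set, R a specification on S, and P a deterministic program on S. Then P is correct with respect to R if and only if its competence domain equals the domain of R, i.e., (dom(R) ⊆ dom(P) and {(s,s') ∈ P | s ∈ dom(R)} ⊆ R) if and only if dom(R ∩ P) = dom(R). -/
/-- The domain of a relation on `S`. -/
def Dom {S : Type*} (R : Set (S × S)) : Set S := {s | ∃ s', (s, s') ∈ R}

/-- A relation is deterministic (a function). -/
def Deterministic {S : Type*} (P : Set (S × S)) : Prop :=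
  ∀ s s' s'', (s, s') ∈ P → (s, s'') ∈ P → s' = s''

/-- A deterministic program is correct with respect to `R` iff its competence
domain equals the domain of `R`. -/
theorem correct_iff_competence_domain_eq_dom {S : Type*} (R P : Set (S × S))
    (hP : Deterministic P) :
    (Dom R ⊆ Dom P ∧ {p : S × S | p ∈ P ∧ p.1 ∈ Dom R} ⊆ R) ↔
      Dom (R ∩ P) = Dom R := by
  constructor
  · rintro ⟨hdom, hsub⟩
    ext s
    constructor
    · rintro ⟨t, hR, _⟩
      exact ⟨t, hR⟩
    · intro hs
      obtain ⟨t, ht⟩ := hdom hs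
      exact ⟨t, hsub ⟨ht, hs⟩, ht⟩
  · intro h
    refine ⟨?_, ?_⟩
    · intro s hs
      rw [← h] at hs
      obtain ⟨t, _, ht⟩ := hs
      exact ⟨t, ht⟩
    · rintro ⟨s, t⟩ ⟨ht, hs⟩
      rw [← h] at hs
      obtain ⟨u, huR, huP⟩ := hs
      have htu : t = u := hP s t u ht huP
      rw [htu]
      exact huR
end

section
/- Refinement is equivalent to universal relative correctness: let S be a set and P and P' two deterministic programs on S. Then P' refines P (i.e., dom(P) ⊆ dom(P') and {(s,s') ∈ P' | s ∈ dom(P)} ⊆ P) if and only if for every relation (specification) R on S, P' is more-correct than P with respect to R, i.e., dom(R ∩ P) ⊆ dom(R ∩ P') for all R ⊆ S×S. -/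
/-- For deterministic programs, `P'` refines `P` iff `P'` is more-correct than
`P` with respect to every specification `R`. -/
theorem refines_iff_universally_more_correct {S : Type*} (P P' : Set (S × S))
    (hP : Deterministic P) (hP' : Deterministic P') :
    (Dom P ⊆ Dom P' ∧ {p : S × S | p ∈ P' ∧ p.1 ∈ Dom P} ⊆ P) ↔
      ∀ R : Set (S × S), Dom (R ∩ P) ⊆ Dom (R ∩ P') := by
  constructor
  · rintro ⟨hd, hs⟩ R s ⟨t, hR, ht⟩
    obtain ⟨u, hu⟩ := hd ⟨t, ht⟩
    have hu' : (s, u) ∈ P := hs ⟨hu, t, ht⟩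
    have e : u = t := hP s u t hu' ht
    subst e
    exact ⟨u, hR, hu⟩
  · intro h
    have key : ∀ s t, (s, t) ∈ P → (s, t) ∈ P' := by
      intro s t ht
      obtain ⟨u, hR, hu⟩ := h {(s, t)} ⟨t, rfl, ht⟩
      rw [Set.mem_singleton_iff] at hR
      rwa [hR] at hu
    refine ⟨fun s ⟨t, ht⟩ => ⟨t, key s t ht⟩, ?_⟩
    rintro ⟨s, u⟩ ⟨hu, t, ht⟩
    have e : u = t := hP' s u t hu (key s t ht)
    rw [e]
    exact ht
end

section
/- The projection operator is idempotent: for any relations R (a specification) and P (a program) on a set S, Π_R(Π_R(P)) = Π_R(P), where Π_R(P) = (R ∩ P)L ∩ (R ∪ P) = {(s,s') ∈ R ∪ P | s ∈ dom(R ∩ P)}. -/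
/-- The projection of a program `P` over a specification `R`:
`Π_R(P) = (R ∩ P)L ∩ (R ∪ P)`. -/
def Proj {S : Type*} (R P : Set (S × S)) : Set (S × S) :=
  {p | p ∈ R ∪ P ∧ p.1 ∈ Dom (R ∩ P)}

/-- The projection operator is idempotent: `Π_R(Π_R(P)) = Π_R(P)`. -/
theorem proj_idempotent {S : Type*} (R P : Set (S × S)) :
    Proj R (Proj R P) = Proj R P := by
  ext ⟨a, b⟩
  constructor
  · rintro ⟨h, c, hR, -, hd⟩
    refine ⟨?_, hd⟩
    rcases h with h | h
    · exact Or.inl h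
    · exact h.1
  · rintro ⟨h, c, hR, hP⟩
    exact ⟨Or.inr ⟨h, c, hR, hP⟩, c, hR, Or.inl hR, c, hR, hP⟩
end

section
/- A program P is correct with respect to a specification R if and only if the projection of P over R equals R: for any relations R and P on a set S, (dom(R) ⊆ dom(P) and {(s,s') ∈ P | s ∈ dom(R)} ⊆ R) if and only if Π_R(P) = R, where Π_R(P) = {(s,s') ∈ R ∪ P | s ∈ dom(R ∩ P)}. -/
/-- `P` is correct with respect to `R` iff `Π_R(P) = R`. -/
theorem correct_iff_proj_eq_spec {S : Type*} (R P : Set (S × S)) :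
    (Dom R ⊆ Dom P ∧ {p : S × S | p ∈ P ∧ p.1 ∈ Dom R} ⊆ R) ↔
      Proj R P = R := by
  constructor
  · rintro ⟨hd, hs⟩
    ext ⟨a, b⟩
    constructor
    · rintro ⟨h | h, c, hc⟩
      · exact h
      · exact hs ⟨h, c, hc.1⟩
    · intro h
      obtain ⟨c, hc⟩ := hd ⟨b, h⟩
      exact ⟨Or.inl h, c, hs ⟨hc, b, h⟩, hc⟩
  · intro h
    have key : ∀ a b, (a, b) ∈ R → a ∈ Dom (R ∩ P) := by
      intro a b hab
      rw [← h] at hab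
      exact hab.2
    constructor
    · rintro a ⟨b, hab⟩
      obtain ⟨c, hc⟩ := key a b hab
      exact ⟨c, hc.2⟩
    · rintro ⟨a, b⟩ ⟨hp, c, hc⟩
      have hm : (a, b) ∈ Proj R P := ⟨Or.inr hp, key a c hc⟩
      rw [h] at hm
      exact hm
end
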